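/- The polynomial X⁴ + 10·X² − 155 is irreducible over ℚ, and for every prime number p there exist x, y, z ∈ ℚ_p satisfying y² − 17·z² = 137·(x⁴ + 10·x² − 155). -/

import Mathlib

open Polynomial

/-- `X⁴ + 10X² - 155` is irreducible over `ℤ`, by Eisenstein's criterion at `5`. -/
theorem irreducible_quartic_int : Irreducible (X ^ 4 + 10 * X ^ 2 - 155 : ℤ[X]) := by
  have hC : (X ^ 4 + 10 * X ^ 2 - 155 : ℤ[X]) = X ^ 4 + C 10 * X ^ 2 - C 155 := by simp
  have hm : (X ^ 4 + C 10 * X ^ 2 - C 155 : ℤ[X]).Monic := by monicity!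
  have hd : (X ^ 4 + C 10 * X ^ 2 - C 155 : ℤ[X]).natDegree = 4 := by compute_degree!
  rw [hC]
  have h5 : Prime (5 : ℤ) := Int.prime_iff_natAbs_prime.mpr (by norm_num)
  have hP : (Ideal.span {(5 : ℤ)}).IsPrime :=
    (Ideal.span_singleton_prime (by norm_num)).mpr h5
  refine IsEisensteinAt.irreducible (𝓟 := Ideal.span {(5 : ℤ)}) ⟨?_, ?_, ?_⟩ hP hm.isPrimitive
    (by rw [hd]; norm_num)
  · rw [hm.leadingCoeff, Ideal.mem_span_singleton]
    norm_num
  · intro n hn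
    rw [hd] at hn
    rw [Ideal.mem_span_singleton]
    interval_cases n <;> simp [coeff_X_pow]
  · rw [Ideal.span_singleton_pow, Ideal.mem_span_singleton]
    simp [coeff_X_pow]

/-- The explicit example over `ℚ`: `X⁴ + 10X² - 155` is irreducible over `ℚ` and the Châtelet
surface `y² - 17z² = 137(x⁴ + 10x² - 155)` has `ℚ_p`-points for every prime `p`. -/
theorem stmt_10 :
    Irreducible (X ^ 4 + 10 * X ^ 2 - 155 : ℚ[X]) ∧
      ∀ (p : ℕ) [Fact p.Prime],
        ∃ x y z : ℚ_[p], y ^ 2 - 17 * z ^ 2 = 137 * (x ^ 4 + 10 * x ^ 2 - 155) := by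
  refine ⟨?_, fun p _ => ⟨1, 48, 36, by norm_num⟩⟩
  have hm : (X ^ 4 + 10 * X ^ 2 - 155 : ℤ[X]).Monic := by monicity!
  have h := hm.isPrimitive.irreducible_iff_irreducible_map_fraction_map (K := ℚ) |>.mp
    irreducible_quartic_int
  simpa using h
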